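/- There is no ring homomorphism r : Filter.Germ (Filter.hyperfilter ℕ) ℚ →+* ℚ with r (↑q) = q for every q : ℚ. That is, the field of rational numbers, being an infinite algebra, is not a retract of its enlargement *ℚ. -/

import Mathlib

/-- The field of rational numbers, being infinite, is not a retract of its enlargement *ℚ:
no ring homomorphism from the ultrapower of ℚ over the hyperfilter to ℚ fixes all
constant germs. -/
theorem stmt_8 :
    ¬ ∃ r : Filter.Germ (Filter.hyperfilter ℕ : Filter ℕ) ℚ →+* ℚ,
        ∀ q : ℚ, r (Filter.Germ.const q) = q := by
  rintro ⟨r, hr⟩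
  let x : Filter.Germ (Filter.hyperfilter ℕ : Filter ℕ) ℚ :=
    Filter.Germ.ofFun (fun n : ℕ => (n : ℚ))
  have h : x = Filter.Germ.const (r x) := r.injective (hr (r x)).symm
  have h2 : ∀ᶠ n : ℕ in (Filter.hyperfilter ℕ : Filter ℕ), (n : ℚ) = r x :=
    Filter.Germ.coe_eq.1 h
  have hfin : Set.Finite {n : ℕ | (n : ℚ) = r x} := by
    apply Set.Subsingleton.finite
    intro a ha b hb
    have hab : (a : ℚ) = b := Eq.trans ha (Eq.symm hb)
    exact_mod_cast hab
  exact Filter.notMem_hyperfilter_of_finite hfin h2
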